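/- Let 𝒜 be a finite hyperplane arrangement in ℝⁿ, D a chamber, and A a face with A ≺ D. Then for every chamber C with ε_H(C) = ε_H(D̃_A) for all H ∈ 𝒜_A (where D̃_A is the chamber opposite D across A), one has ∑_{F : A ≼ F ≼ D} (−1)^{rk F} [FC = D] = (−1)^{rk D}, and this sum is 0 for every other chamber C. Consequently ∑_{A ≼ F ≼ D} (−1)^{rk F} ∑_{C : FC = D} x_C = (−1)^{rk D} ∑_{C : AC = D̃_A} x_C for any assignment of values x_C to chambers. -/

import Mathlib

attribute [local instance] Classical.propDecidable

noncomputable section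

namespace Varchenko

/-- Sign of the point `x` with respect to the hyperplane `⟨a i, x⟩ = b i`. -/
def hsign {n : ℕ} {ι : Type*} (a : ι → Fin n → ℝ) (b : ι → ℝ) (i : ι)
    (x : Fin n → ℝ) : SignType :=
  SignType.sign (∑ j, a i j * x j - b i)

/-- The set of points realizing the sign vector `σ`. -/
def cell {n : ℕ} {ι : Type*} (a : ι → Fin n → ℝ) (b : ι → ℝ)
    (σ : ι → SignType) : Set (Fin n → ℝ) :=
  {x | ∀ i, hsign a b i x = σ i}

/-- A face is a sign vector with nonempty realization. -/
def IsFace {n : ℕ} {ι : Type*} (a : ι → Fin n → ℝ) (b : ι → ℝ)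
    (σ : ι → SignType) : Prop :=
  (cell a b σ).Nonempty

/-- A chamber is a face all of whose signs are nonzero. -/
def IsChamber {n : ℕ} {ι : Type*} (a : ι → Fin n → ℝ) (b : ι → ℝ)
    (σ : ι → SignType) : Prop :=
  IsFace a b σ ∧ ∀ i, σ i ≠ 0

/-- The Tits product of two sign vectors. -/
def tits {ι : Type*} (σ τ : ι → SignType) : ι → SignType :=
  fun i => if σ i ≠ 0 then σ i else τ i

/-- The face partial order on sign vectors. -/
def faceLE {ι : Type*} (σ τ : ι → SignType) : Prop :=
  ∀ i, σ i ≠ 0 → σ i = τ i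

/-- The Aguiar–Mahajan distance function, valued in `ℤ[h_H^± : H ∈ 𝒜]`,
where the variable `h_H^ε` is `X (H, ε)`. -/
def vdist {ι : Type*} [Fintype ι] (C D : ι → SignType) :
    MvPolynomial (ι × SignType) ℤ :=
  ∏ i ∈ Finset.univ.filter (fun i => C i = -D i), MvPolynomial.X (i, C i)

/-- The set of half-spaces containing `C` but not `D`. -/
def Hset {ι : Type*} [Fintype ι] (C D : ι → SignType) : Finset (ι × SignType) :=
  (Finset.univ.filter (fun i => C i = -D i)).image (fun i => (i, C i))

/-- The weight `b_F = ∏_{H ∈ 𝒜_F} h_H⁺ h_H⁻` of a face. -/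
def weight {ι : Type*} [Fintype ι] (σ : ι → SignType) :
    MvPolynomial (ι × SignType) ℤ :=
  ∏ i ∈ Finset.univ.filter (fun i => σ i = 0),
    (MvPolynomial.X (i, 1) * MvPolynomial.X (i, -1))

/-- The dimension of a face. -/
def fdim {n : ℕ} {ι : Type*} (a : ι → Fin n → ℝ) (b : ι → ℝ)
    (σ : ι → SignType) : ℕ :=
  Module.finrank ℝ (affineSpan ℝ (cell a b σ)).direction

/-- The minimal dimension `c_𝒜` of a face of the arrangement. -/
def minDim {n : ℕ} {ι : Type*} (a : ι → Fin n → ℝ) (b : ι → ℝ) : ℕ :=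
  sInf {d : ℕ | ∃ σ, IsFace a b σ ∧ fdim a b σ = d}

/-- The hyperplane with index `i`, as a set. -/
def hplane {n : ℕ} {ι : Type*} (a : ι → Fin n → ℝ) (b : ι → ℝ) (i : ι) :
    Set (Fin n → ℝ) :=
  {x | hsign a b i x = 0}

/-- The multiplicity `β_F^H` of a face `F`, computed using `H ∈ 𝒜_F`. -/
def betaH {n : ℕ} {ι : Type*} [Fintype ι] (a : ι → Fin n → ℝ) (b : ι → ℝ)
    (i : ι) (σ : ι → SignType) : ℕ :=
  (Finset.univ.filter (fun C : ι → SignType => IsChamber a b C ∧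
    closure (cell a b C) ∩ hplane a b i = cell a b σ)).card / 2

end Varchenko

namespace Varchenko

/-- The linear part of the affine form defining the `i`-th hyperplane. -/
def normalForm {n : ℕ} {ι : Type*} (a : ι → Fin n → ℝ) (i : ι) :
    (Fin n → ℝ) →ₗ[ℝ] ℝ :=
  ∑ j, a i j • LinearMap.proj j

lemma normalForm_apply {n : ℕ} {ι : Type*} (a : ι → Fin n → ℝ) (i : ι) (v : Fin n → ℝ) :
    normalForm a i v = ∑ j, a i j * v j := by
  simp [normalForm]

lemma hsign_eq {n : ℕ} {ι : Type*} (a : ι → Fin n → ℝ) (b : ι → ℝ) (i : ι) (x : Fin n → ℝ) :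
    hsign a b i x = SignType.sign (normalForm a i x - b i) := by
  rw [normalForm_apply, hsign]

/-- The points realizing the sign vector `σ` outside of `K`. -/
def partialCell {n : ℕ} {ι : Type*} (a : ι → Fin n → ℝ) (b : ι → ℝ) (K : Finset ι)
    (σ : ι → SignType) : Set (Fin n → ℝ) :=
  {x | ∀ i, i ∉ K → hsign a b i x = σ i}

/-- The linear subspace parallel to a nonempty `partialCell`. -/
def partialDir {n : ℕ} {ι : Type*} (a : ι → Fin n → ℝ) (K : Finset ι)
    (σ : ι → SignType) : Submodule ℝ (Fin n → ℝ) where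
  carrier := {v | ∀ i, i ∉ K → σ i = 0 → normalForm a i v = 0}
  add_mem' hv hw i hi hs := by rw [map_add, hv i hi hs, hw i hi hs, add_zero]
  zero_mem' _ _ _ := map_zero _
  smul_mem' c v hv i hi hs := by rw [map_smul, hv i hi hs, smul_zero]

lemma mem_partialDir {n : ℕ} {ι : Type*} {a : ι → Fin n → ℝ} {K : Finset ι}
    {σ : ι → SignType} {v : Fin n → ℝ} :
    v ∈ partialDir a K σ ↔ ∀ i, i ∉ K → σ i = 0 → normalForm a i v = 0 :=
  Iff.rfl

lemma eventually_hsign_add_smul {n : ℕ} {ι : Type*} (a : ι → Fin n → ℝ) (b : ι → ℝ) (i : ι)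
    (x v : Fin n → ℝ) (h : hsign a b i x = 0 → normalForm a i v = 0) :
    ∀ᶠ t : ℝ in nhds 0, hsign a b i (x + t • v) = hsign a b i x := by
  simp only [hsign_eq, map_add, map_smul, smul_eq_mul] at h ⊢
  by_cases h0 : normalForm a i x - b i = 0
  · simp [h (by simp [h0])]
  · have h1 : ContinuousAt (fun t : ℝ => SignType.sign
        (normalForm a i x + t * normalForm a i v - b i)) 0 := by
      apply ContinuousAt.comp (g := SignType.sign)
      · exact continuousAt_sign_of_ne_zero (by simpa using h0)
      · fun_prop
    filter_upwards [h1 ((isOpen_discrete {SignType.sign (normalForm a i x - b i)}).mem_nhds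
      (by simp))] with t ht using ht

lemma eventually_mem_partialCell {n : ℕ} {ι : Type*} [Fintype ι] {a : ι → Fin n → ℝ} {b : ι → ℝ}
    {K : Finset ι} {σ : ι → SignType} {x v : Fin n → ℝ} (hx : x ∈ partialCell a b K σ)
    (hv : v ∈ partialDir a K σ) :
    ∀ᶠ t : ℝ in nhds 0, x + t • v ∈ partialCell a b K σ := by
  simp only [partialCell, Set.mem_ofPred_eq, Filter.eventually_all]
  intro i hi
  filter_upwards [eventually_hsign_add_smul a b i x v
    (fun h => hv i hi (by rw [← hx i hi, h]))] with t ht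
  rw [ht, hx i hi]

lemma exists_pos_of_eventually_nhds_zero {p : ℝ → Prop} (h : ∀ᶠ t in nhds (0 : ℝ), p t) :
    ∃ t, 0 < t ∧ p t ∧ p (-t) := by
  obtain ⟨ε, hε, H⟩ := Metric.eventually_nhds_iff.1 h
  refine ⟨ε / 2, by positivity, H ?_, H ?_⟩ <;>
    simp [abs_of_pos hε, hε]

lemma direction_affineSpan_cell {n : ℕ} {ι : Type*} [Fintype ι] {a : ι → Fin n → ℝ} {b : ι → ℝ}
    {σ : ι → SignType} (h : IsFace a b σ) :
    (affineSpan ℝ (cell a b σ)).direction = partialDir a ∅ σ := by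
  rw [direction_affineSpan]
  apply le_antisymm
  · rw [vectorSpan_def, Submodule.span_le]
    rintro _ ⟨x, hx, y, hy, rfl⟩ i - hs
    have h1 := hx i
    have h2 := hy i
    rw [hs, hsign_eq, sign_eq_zero_iff] at h1 h2
    simp only [vsub_eq_sub, map_sub]
    linarith
  · intro v hv
    obtain ⟨x, hx⟩ := h
    obtain ⟨t, ht, h1, -⟩ := exists_pos_of_eventually_nhds_zero
      (eventually_mem_partialCell (a := a) (b := b) (K := ∅) (σ := σ) (fun i _ => hx i) hv)
    have h2 := vsub_mem_vectorSpan ℝ (s := cell a b σ) (fun i => h1 i (by simp)) hx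
    simp only [vsub_eq_sub, add_sub_cancel_left] at h2
    exact (Submodule.smul_mem_iff _ ht.ne').1 h2

/-- The Euler characteristic with compact support of a `partialCell`. -/
def partialEuler {n : ℕ} {ι : Type*} (a : ι → Fin n → ℝ) (b : ι → ℝ) (K : Finset ι)
    (σ : ι → SignType) : ℤ :=
  if (partialCell a b K σ).Nonempty then (-1) ^ Module.finrank ℝ (partialDir a K σ) else 0

lemma mem_partialCell_update {n : ℕ} {ι : Type*} {a : ι → Fin n → ℝ} {b : ι → ℝ}
    {K : Finset ι} {σ : ι → SignType} {i : ι} (hi : i ∉ K) {s : SignType} {x : Fin n → ℝ} :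
    x ∈ partialCell a b K (Function.update σ i s) ↔
      x ∈ partialCell a b (insert i K) σ ∧ hsign a b i x = s := by
  constructor
  · intro h
    refine ⟨fun j hj => ?_, by simpa using h i hi⟩
    simp only [Finset.mem_insert, not_or] at hj
    simpa [Function.update_of_ne hj.1] using h j hj.2
  · rintro ⟨h, hs⟩ j hj
    by_cases hji : j = i
    · subst hji; simpa using hs
    · rw [Function.update_of_ne hji]
      exact h j (by simp [hji, hj])

lemma partialDir_update_of_ne_zero {n : ℕ} {ι : Type*} (a : ι → Fin n → ℝ)
    (K : Finset ι) (σ : ι → SignType) (i : ι) {s : SignType} (hs : s ≠ 0) :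
    partialDir a K (Function.update σ i s) = partialDir a (insert i K) σ := by
  ext v
  simp only [mem_partialDir, Finset.mem_insert, not_or, and_imp]
  refine forall_congr' fun j => ?_
  by_cases hji : j = i
  · subst hji; simp [hs]
  · simp [hji]

lemma partialDir_update_zero {n : ℕ} {ι : Type*} (a : ι → Fin n → ℝ)
    {K : Finset ι} (σ : ι → SignType) {i : ι} (hi : i ∉ K) :
    partialDir a K (Function.update σ i 0) =
      partialDir a (insert i K) σ ⊓ LinearMap.ker (normalForm a i) := by
  ext v
  simp only [Submodule.mem_inf, mem_partialDir, Finset.mem_insert, not_or, and_imp,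
    LinearMap.mem_ker]
  constructor
  · intro h
    exact ⟨fun j hji hj hs => h j hj (by simpa [hji] using hs), h i hi (by simp)⟩
  · rintro ⟨h, h0⟩ j hj hs
    by_cases hji : j = i
    · subst hji; exact h0
    · exact h j hji hj (by simpa [hji] using hs)

lemma finrank_inf_ker_add_one {V : Type*} [AddCommGroup V] [Module ℝ V] [FiniteDimensional ℝ V]
    (W : Submodule ℝ V) (f : V →ₗ[ℝ] ℝ) {v : V} (hv : v ∈ W) (hf : f v ≠ 0) :
    Module.finrank ℝ (W ⊓ LinearMap.ker f : Submodule ℝ V) + 1 = Module.finrank ℝ W := by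
  have h : (f ∘ₗ W.subtype : Module.Dual ℝ W) ≠ 0 := fun h =>
    hf (by simpa using LinearMap.congr_fun h ⟨v, hv⟩)
  rw [← Module.Dual.finrank_ker_add_one_of_ne_zero h, LinearMap.ker_comp,
    ← Submodule.map_comap_subtype, Submodule.finrank_map_subtype_eq]

lemma exists_hsign_eq_zero {n : ℕ} {ι : Type*} {a : ι → Fin n → ℝ} {b : ι → ℝ}
    {K : Finset ι} {σ : ι → SignType} {i : ι} {x y : Fin n → ℝ}
    (hx : x ∈ partialCell a b K σ) (hy : y ∈ partialCell a b K σ)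
    (hxi : hsign a b i x = 1) (hyi : hsign a b i y = -1) :
    ∃ z ∈ partialCell a b K σ, hsign a b i z = 0 := by
  simp only [hsign_eq, sign_eq_one_iff, sign_eq_neg_one_iff] at hxi hyi
  set p := normalForm a i x - b i with hp
  set q := normalForm a i y - b i with hq
  have hpq : 0 < p - q := by linarith
  have key : ∀ j, normalForm a j ((-q / (p - q)) • x + (p / (p - q)) • y) - b j =
      (-q / (p - q)) * (normalForm a j x - b j) + (p / (p - q)) * (normalForm a j y - b j) := by
    intro j
    simp only [map_add, map_smul, smul_eq_mul]
    field_simp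
    ring
  have hq' : 0 < -q / (p - q) := div_pos (by linarith) hpq
  have hp' : 0 < p / (p - q) := div_pos hxi hpq
  refine ⟨(-q / (p - q)) • x + (p / (p - q)) • y, fun j hj => ?_, ?_⟩
  · have h1 := hx j hj
    have h2 := hy j hj
    rw [hsign_eq] at h1 h2 ⊢
    rw [key j]
    rcases hs : σ j with _ | _ | _
    · rw [hs] at h1 h2
      replace h1 := sign_eq_zero_iff.1 h1
      replace h2 := sign_eq_zero_iff.1 h2
      exact sign_eq_zero_iff.2 (by rw [h1, h2]; ring)
    · rw [hs] at h1 h2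
      replace h1 := sign_eq_neg_one_iff.1 h1
      replace h2 := sign_eq_neg_one_iff.1 h2
      exact sign_eq_neg_one_iff.2 (by nlinarith)
    · rw [hs] at h1 h2
      replace h1 := sign_eq_one_iff.1 h1
      replace h2 := sign_eq_one_iff.1 h2
      exact sign_eq_one_iff.2 (by positivity)
  · rw [hsign_eq, key i, ← hp, ← hq, sign_eq_zero_iff]
    field_simp
    ring

lemma sum_signType {M : Type*} [AddCommMonoid M] (f : SignType → M) :
    ∑ s, f s = f 0 + f (-1) + f 1 := by
  have h : (Finset.univ : Finset SignType) = {0, -1, 1} := rfl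
  rw [h, Finset.sum_insert (by decide), Finset.sum_insert (by decide), Finset.sum_singleton,
    add_assoc]

lemma partialEuler_insert {n : ℕ} {ι : Type*} [Fintype ι] (a : ι → Fin n → ℝ) (b : ι → ℝ)
    {K : Finset ι} (σ : ι → SignType) {i : ι} (hi : i ∉ K) :
    partialEuler a b (insert i K) σ = ∑ s, partialEuler a b K (Function.update σ i s) := by
  have hne : ∀ s, (partialCell a b K (Function.update σ i s)).Nonempty ↔
      ∃ x ∈ partialCell a b (insert i K) σ, hsign a b i x = s := fun s =>
    exists_congr fun x => mem_partialCell_update hi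
  rw [sum_signType]
  simp only [partialEuler, hne]
  rw [partialDir_update_zero a σ hi,
    partialDir_update_of_ne_zero a K σ i (s := -1) (by decide),
    partialDir_update_of_ne_zero a K σ i (s := 1) (by decide)]
  set X := partialCell a b (insert i K) σ with hX
  set W := partialDir a (insert i K) σ with hW
  by_cases hXne : X.Nonempty
  swap
  · have h : ∀ s, ¬ ∃ x ∈ X, hsign a b i x = s := fun s ⟨x, hx, _⟩ => hXne ⟨x, hx⟩
    simp [h, hXne]
  rw [if_pos hXne]
  have h3 : ∀ x, hsign a b i x = 0 ∨ hsign a b i x = -1 ∨ hsign a b i x = 1 := fun x => by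
    rcases hsign a b i x with _ | _ | _ <;> simp
  have hpm : (∃ x ∈ X, hsign a b i x = 1) → (∃ x ∈ X, hsign a b i x = -1) →
      ∃ x ∈ X, hsign a b i x = 0 := fun ⟨x, hx, hx1⟩ ⟨y, hy, hy1⟩ =>
    exists_hsign_eq_zero hx hy hx1 hy1
  by_cases h0 : ∃ x ∈ X, hsign a b i x = 0
  · obtain ⟨x, hx, hx0⟩ := id h0
    by_cases hv : ∃ v ∈ W, normalForm a i v ≠ 0
    · obtain ⟨v, hvW, hv0⟩ := hv
      have hd := finrank_inf_ker_add_one W (normalForm a i) hvW hv0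
      obtain ⟨t, ht, ht1, ht2⟩ :=
        exists_pos_of_eventually_nhds_zero (eventually_mem_partialCell hx hvW)
      rw [hsign_eq, sign_eq_zero_iff] at hx0
      have e1 : normalForm a i (x + t • v) - b i = t * normalForm a i v := by
        simp only [map_add, map_smul, smul_eq_mul]; linarith
      have e2 : normalForm a i (x + (-t) • v) - b i = -(t * normalForm a i v) := by
        simp only [map_add, map_smul, smul_eq_mul]; linarith
      have hboth : (∃ x ∈ X, hsign a b i x = -1) ∧ (∃ x ∈ X, hsign a b i x = 1) := by
        rcases lt_or_gt_of_ne hv0 with hneg | hpos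
        · have hm := mul_neg_of_pos_of_neg ht hneg
          exact ⟨⟨_, ht1, by rw [hsign_eq, e1, sign_eq_neg_one_iff]; exact hm⟩,
            ⟨_, ht2, by rw [hsign_eq, e2, sign_eq_one_iff]; linarith⟩⟩
        · have hm := mul_pos ht hpos
          exact ⟨⟨_, ht2, by rw [hsign_eq, e2, sign_eq_neg_one_iff]; linarith⟩,
            ⟨_, ht1, by rw [hsign_eq, e1, sign_eq_one_iff]; exact hm⟩⟩
      rw [if_pos h0, if_pos hboth.1, if_pos hboth.2, ← hd, pow_succ]
      ring
    · push Not at hv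
      have hconst : ∀ y ∈ X, hsign a b i y = 0 := by
        intro y hy
        have hyx : y - x ∈ W := by
          intro j hj hs
          have h1 := hx j hj
          have h2 := hy j hj
          rw [hs, hsign_eq, sign_eq_zero_iff] at h1 h2
          rw [map_sub]
          linarith
        have h4 := hv _ hyx
        rw [hsign_eq, sign_eq_zero_iff] at hx0 ⊢
        rw [map_sub] at h4
        linarith
      have hm : ∀ s, s ≠ 0 → ¬ ∃ x ∈ X, hsign a b i x = s := fun s hs ⟨y, hy, hys⟩ =>
        hs (by rw [← hys, hconst y hy])
      have hinf : W ⊓ LinearMap.ker (normalForm a i) = W := inf_eq_left.2 hv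
      rw [if_pos h0, if_neg (hm _ (by decide)), if_neg (hm _ (by decide)), hinf]
      ring
  · obtain ⟨x, hx⟩ := hXne
    rw [if_neg h0]
    rcases h3 x with h | h | h
    · exact absurd ⟨x, hx, h⟩ h0
    · have h5 : ∃ x ∈ X, hsign a b i x = -1 := ⟨x, hx, h⟩
      rw [if_pos h5, if_neg fun h6 => h0 (hpm h6 h5)]
      ring
    · have h5 : ∃ x ∈ X, hsign a b i x = 1 := ⟨x, hx, h⟩
      rw [if_pos h5, if_neg fun h6 => h0 (hpm h5 h6)]
      ring

lemma sum_faces_eq_partialEuler {n : ℕ} {ι : Type*} [Fintype ι] (a : ι → Fin n → ℝ) (b : ι → ℝ)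
    (K : Finset ι) (σ : ι → SignType) :
    ∑ F ∈ Finset.univ.filter (fun F : ι → SignType => IsFace a b F ∧ ∀ i, i ∉ K → F i = σ i),
      (-1 : ℤ) ^ fdim a b F = partialEuler a b K σ := by
  induction K using Finset.induction_on generalizing σ with
  | empty =>
    have h1 : ∀ F : ι → SignType, (IsFace a b F ∧ ∀ i, i ∉ (∅ : Finset ι) → F i = σ i) ↔
        IsFace a b σ ∧ F = σ := fun F => by
      simp only [Finset.notMem_empty, not_false_eq_true, forall_const, ← funext_iff]
      constructor <;> rintro ⟨h, rfl⟩ <;> exact ⟨h, rfl⟩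
    have h2 : partialCell a b ∅ σ = cell a b σ := by simp [partialCell, cell]
    simp only [h1, partialEuler, h2]
    by_cases h : IsFace a b σ
    · rw [if_pos (show (cell a b σ).Nonempty from h), ← direction_affineSpan_cell h]
      simp [h, Finset.filter_eq', fdim]
    · rw [if_neg (show ¬ (cell a b σ).Nonempty from h)]
      simp [h]
  | insert i K hi ih =>
    rw [partialEuler_insert a b σ hi, ← Finset.sum_fiberwise _ (fun F => F i)]
    refine Finset.sum_congr rfl fun s _ => ?_
    rw [← ih, Finset.filter_filter]
    refine Finset.sum_congr (Finset.filter_congr fun F _ => ?_) fun _ _ => rfl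
    constructor
    · rintro ⟨⟨h, h1⟩, rfl⟩
      refine ⟨h, fun j hj => ?_⟩
      by_cases hji : j = i
      · subst hji; simp
      · rw [Function.update_of_ne hji]
        exact h1 j (by simp [hji, hj])
    · rintro ⟨h, h1⟩
      refine ⟨⟨h, fun j hj => ?_⟩, by simpa using h1 i hi⟩
      simp only [Finset.mem_insert, not_or] at hj
      simpa [Function.update_of_ne hj.1] using h1 j hj.2

lemma partialEuler_of_isChamber {n : ℕ} {ι : Type*} {a : ι → Fin n → ℝ} {b : ι → ℝ}
    {E : ι → SignType} (hE : IsChamber a b E) (K : Finset ι) :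
    partialEuler a b K E = (-1) ^ n := by
  have h1 : partialDir a K E = ⊤ :=
    eq_top_iff.2 fun v _ i _ h => absurd h (hE.2 i)
  obtain ⟨x, hx⟩ := hE.1
  rw [partialEuler, if_pos ⟨x, fun i _ => hx i⟩, h1, finrank_top]
  simp

/-- The alternating sum over the faces which agree with a chamber `E` outside of `K` and disagree
with it everywhere on a nonempty subset `P` of `K` vanishes. -/
lemma sum_faces_ne_chamber {n : ℕ} {ι : Type*} [Fintype ι] {a : ι → Fin n → ℝ} {b : ι → ℝ}
    {E : ι → SignType} (hE : IsChamber a b E) {P : Finset ι} (hP : P.Nonempty) (K : Finset ι)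
    (hPK : P ⊆ K) :
    ∑ F ∈ Finset.univ.filter (fun F : ι → SignType =>
        (IsFace a b F ∧ ∀ i, i ∉ K → F i = E i) ∧ ∀ i ∈ P, F i ≠ E i),
      (-1 : ℤ) ^ fdim a b F = 0 := by
  have step : ∀ (p : ι) (P K : Finset ι), p ∈ K →
      ∑ F ∈ Finset.univ.filter (fun F : ι → SignType =>
        (IsFace a b F ∧ ∀ i, i ∉ K → F i = E i) ∧ ∀ i ∈ insert p P, F i ≠ E i),
        (-1 : ℤ) ^ fdim a b F =
      ∑ F ∈ Finset.univ.filter (fun F : ι → SignType =>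
        (IsFace a b F ∧ ∀ i, i ∉ K → F i = E i) ∧ ∀ i ∈ P, F i ≠ E i),
        (-1 : ℤ) ^ fdim a b F -
      ∑ F ∈ Finset.univ.filter (fun F : ι → SignType =>
        (IsFace a b F ∧ ∀ i, i ∉ K.erase p → F i = E i) ∧ ∀ i ∈ P, F i ≠ E i),
        (-1 : ℤ) ^ fdim a b F := by
    intro p P K hp
    rw [eq_sub_iff_add_eq, add_comm, ← Finset.sum_filter_add_sum_filter_not
      (Finset.univ.filter (fun F : ι → SignType =>
        (IsFace a b F ∧ ∀ i, i ∉ K → F i = E i) ∧ ∀ i ∈ P, F i ≠ E i)) (fun F => F p = E p)]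
    simp only [Finset.filter_filter]
    congr 1
    · refine Finset.sum_congr (Finset.filter_congr fun F _ => ?_) fun _ _ => rfl
      constructor
      · rintro ⟨⟨h, h1⟩, h2⟩
        exact ⟨⟨⟨h, fun i hi => h1 i fun h => hi (Finset.mem_of_mem_erase h)⟩, h2⟩,
          h1 p (by simp)⟩
      · rintro ⟨⟨⟨h, h1⟩, h2⟩, h3⟩
        refine ⟨⟨h, fun i hi => ?_⟩, h2⟩
        by_cases hip : i = p
        · rw [hip, h3]
        · exact h1 i fun h => hi (Finset.mem_erase.2 ⟨hip, h⟩)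
    · refine Finset.sum_congr (Finset.filter_congr fun F _ => ?_) fun _ _ => rfl
      simp only [Finset.forall_mem_insert]
      tauto
  induction hP using Finset.Nonempty.cons_induction generalizing K with
  | singleton p =>
    have h := step p ∅ K (hPK (by simp))
    simp only [insert_empty_eq] at h
    rw [h]
    simp only [Finset.notMem_empty, false_imp_iff, implies_true, and_true,
      sum_faces_eq_partialEuler, partialEuler_of_isChamber hE, sub_self]
  | cons p P hp hP ih =>
    rw [Finset.cons_eq_insert] at hPK ⊢
    rw [step p P K (hPK (by simp)), ih K fun i hi => hPK (by simp [hi]),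
      ih (K.erase p) fun i hi => Finset.mem_erase.2 ⟨fun h => hp (h ▸ hi), hPK (by simp [hi])⟩,
      sub_self]

/-- The chamber obtained from a face `A` by moving away from a chamber `C`. -/
lemma isChamber_tits_neg {n : ℕ} {ι : Type*} [Fintype ι] {a : ι → Fin n → ℝ} {b : ι → ℝ}
    {A C : ι → SignType} (hA : IsFace a b A) (hC : IsChamber a b C) :
    IsChamber a b (tits A (-C)) := by
  refine ⟨?_, fun i => ?_⟩
  · obtain ⟨x, hx⟩ := hA
    obtain ⟨c, hc⟩ := hC.1
    have h : ∀ᶠ t : ℝ in nhds 0, ∀ i, A i ≠ 0 → hsign a b i (x + t • (c - x)) = A i := by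
      simp only [Filter.eventually_all]
      intro i hi
      filter_upwards [eventually_hsign_add_smul a b i x (c - x)
        (fun h => absurd ((hx i).symm.trans h) hi)] with t ht
      rw [ht, hx i]
    obtain ⟨t, ht, -, h2⟩ := exists_pos_of_eventually_nhds_zero h
    refine ⟨x + (-t) • (c - x), fun i => ?_⟩
    by_cases hi : A i = 0
    · have h3 := hx i
      rw [hi, hsign_eq, sign_eq_zero_iff] at h3
      have h4 : normalForm a i (x + (-t) • (c - x)) - b i = -(t * (normalForm a i c - b i)) := by
        simp only [map_add, map_smul, map_sub, smul_eq_mul]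
        linear_combination (1 + t) * h3
      rw [hsign_eq, h4, Left.sign_neg, sign_mul, sign_pos ht, one_mul, ← hsign_eq, hc i]
      simp [tits, hi]
    · rw [h2 i hi]
      simp [tits, hi]
  · by_cases hi : A i = 0
    · simpa [tits, hi] using hC.2 i
    · simp [tits, hi]

lemma neg_one_pow_fdim_sub {R : Type*} [CommRing R] {n : ℕ} {ι : Type*} {a : ι → Fin n → ℝ}
    {b : ι → ℝ} {F : ι → SignType} (hF : IsFace a b F) :
    (-1 : R) ^ (fdim a b F - minDim a b) = (-1) ^ minDim a b * (-1) ^ fdim a b F := by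
  have h : minDim a b ≤ fdim a b F := Nat.sInf_le ⟨F, hF, rfl⟩
  obtain ⟨k, hk⟩ := Nat.exists_eq_add_of_le h
  rw [hk, Nat.add_sub_cancel_left, pow_add, ← mul_assoc, ← mul_pow]
  simp

lemma signType_ne_neg_self {s : SignType} (hs : s ≠ 0) : s ≠ -s := by
  revert s
  decide

lemma tits_eq_right_iff {ι : Type*} {F C D : ι → SignType} (hFD : faceLE F D) :
    tits F C = D ↔ ∀ i, F i = 0 → C i = D i := by
  rw [funext_iff]
  refine forall_congr' fun i => ?_
  by_cases hi : F i = 0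
  · simp [tits, hi]
  · simpa [tits, hi] using hFD i hi

lemma sum_tits_eq_of_opposite {n : ℕ} {ι : Type*} [Fintype ι]
    {a : ι → Fin n → ℝ} {b : ι → ℝ} {D A C : ι → SignType} (hD : IsChamber a b D)
    (hAD : faceLE A D) (hC : ∀ i, A i = 0 → C i = -(D i)) :
    ∑ F ∈ Finset.univ.filter (fun F : ι → SignType =>
        IsFace a b F ∧ faceLE A F ∧ faceLE F D ∧ tits F C = D),
      ((-1 : ℤ) ^ (fdim a b F - minDim a b)) = (-1 : ℤ) ^ (fdim a b D - minDim a b) := by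
  have h : Finset.univ.filter (fun F : ι → SignType =>
      IsFace a b F ∧ faceLE A F ∧ faceLE F D ∧ tits F C = D) = {D} := by
    ext F
    simp only [Finset.mem_filter, Finset.mem_univ, true_and, Finset.mem_singleton]
    constructor
    · rintro ⟨-, hAF, hFD, ht⟩
      rw [tits_eq_right_iff hFD] at ht
      funext i
      refine hFD i fun hi => ?_
      have hAi : A i = 0 := by
        by_contra h0
        exact h0 ((hAF i h0).trans hi)
      exact signType_ne_neg_self (hD.2 i) ((ht i hi).symm.trans (hC i hAi))
    · rintro rfl
      exact ⟨hD.1, hAD, fun _ _ => rfl,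
        (tits_eq_right_iff fun _ _ => rfl).2 fun i hi => absurd hi (hD.2 i)⟩
  rw [h, Finset.sum_singleton]

lemma sum_tits_eq_of_not_opposite {n : ℕ} {ι : Type*} [Fintype ι]
    {a : ι → Fin n → ℝ} {b : ι → ℝ} {D A C : ι → SignType} (hD : IsChamber a b D)
    (hA : IsFace a b A) (hAD : faceLE A D) (hC : IsChamber a b C)
    (hCD : ¬ ∀ i, A i = 0 → C i = -(D i)) :
    ∑ F ∈ Finset.univ.filter (fun F : ι → SignType =>
        IsFace a b F ∧ faceLE A F ∧ faceLE F D ∧ tits F C = D),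
      ((-1 : ℤ) ^ (fdim a b F - minDim a b)) = 0 := by
  set P : Finset ι := Finset.univ.filter (fun i => A i = 0 ∧ C i ≠ -(D i)) with hPdef
  have hP : P.Nonempty := by
    push Not at hCD
    obtain ⟨i, hi⟩ := hCD
    exact ⟨i, by simpa [hPdef] using hi⟩
  have hmem : ∀ i, i ∈ P ↔ A i = 0 ∧ C i ≠ -(D i) := fun i => by simp [hPdef]
  have key := sum_faces_ne_chamber (isChamber_tits_neg hA hC) hP P subset_rfl
  rw [Finset.sum_congr rfl fun F hF => neg_one_pow_fdim_sub (Finset.mem_filter.1 hF).2.1,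
    ← Finset.mul_sum]
  refine mul_eq_zero_of_right _ (Eq.trans ?_ key)
  refine Finset.sum_congr (Finset.filter_congr fun F _ => ?_) fun _ _ => rfl
  rw [and_assoc]
  refine and_congr_right fun _ => ?_
  have hpt : (faceLE A F ∧ faceLE F D ∧ tits F C = D) ↔
      ∀ i, (A i ≠ 0 → A i = F i) ∧ (F i ≠ 0 → F i = D i) ∧ (F i = 0 → C i = D i) := by
    constructor
    · rintro ⟨h1, h2, h3⟩ i
      exact ⟨h1 i, h2 i, (tits_eq_right_iff h2).1 h3 i⟩
    · intro h
      have h2 : faceLE F D := fun i => (h i).2.1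
      exact ⟨fun i => (h i).1, h2, (tits_eq_right_iff h2).2 fun i => (h i).2.2⟩
  rw [hpt, ← forall_and]
  refine forall_congr' fun i => ?_
  have hd := hD.2 i
  have hc := hC.2 i
  have had := hAD i
  rw [hmem]
  simp only [tits, Pi.neg_apply]
  generalize A i = s at *
  generalize C i = t at *
  generalize D i = u at *
  generalize F i = w at *
  revert s t u w
  decide

theorem generalized_witt_identity {n : ℕ} {ι : Type*} [Fintype ι]
    {R : Type*} [CommRing R]
    (a : ι → Fin n → ℝ) (b : ι → ℝ) (ha : ∀ i, a i ≠ 0)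
    (D A : ι → SignType) (hD : IsChamber a b D) (hA : IsFace a b A)
    (hAD : faceLE A D) (hne : A ≠ D) (x : (ι → SignType) → R) :
    (∀ C : ι → SignType, IsChamber a b C →
      (∀ i, A i = 0 → C i = -(D i)) →
      ∑ F ∈ Finset.univ.filter (fun F : ι → SignType =>
          IsFace a b F ∧ faceLE A F ∧ faceLE F D ∧ tits F C = D),
        ((-1 : ℤ) ^ (fdim a b F - minDim a b)) =
          (-1 : ℤ) ^ (fdim a b D - minDim a b)) ∧
    (∀ C : ι → SignType, IsChamber a b C →
      ¬ (∀ i, A i = 0 → C i = -(D i)) →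
      ∑ F ∈ Finset.univ.filter (fun F : ι → SignType =>
          IsFace a b F ∧ faceLE A F ∧ faceLE F D ∧ tits F C = D),
        ((-1 : ℤ) ^ (fdim a b F - minDim a b)) = 0) ∧
    (∑ F ∈ Finset.univ.filter (fun F : ι → SignType =>
        IsFace a b F ∧ faceLE A F ∧ faceLE F D),
      ((-1 : R) ^ (fdim a b F - minDim a b)) *
        ∑ C ∈ Finset.univ.filter (fun C : ι → SignType =>
            IsChamber a b C ∧ tits F C = D), x C =
      ((-1 : R) ^ (fdim a b D - minDim a b)) *
        ∑ C ∈ Finset.univ.filter (fun C : ι → SignType =>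
            IsChamber a b C ∧
              tits A C = (fun i => if A i = 0 then -(D i) else A i)), x C) := by
  have h1 : ∀ C : ι → SignType, IsChamber a b C → (∀ i, A i = 0 → C i = -(D i)) → _ :=
    fun C _ h => sum_tits_eq_of_opposite hD hAD h
  have h2 : ∀ C : ι → SignType, IsChamber a b C → ¬ (∀ i, A i = 0 → C i = -(D i)) → _ :=
    fun C hC h => sum_tits_eq_of_not_opposite hD hA hAD hC h
  refine ⟨h1, h2, ?_⟩
  have hopp : ∀ C : ι → SignType,
      tits A C = (fun i => if A i = 0 then -(D i) else A i) ↔ ∀ i, A i = 0 → C i = -(D i) := by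
    intro C
    rw [funext_iff]
    refine forall_congr' fun i => ?_
    by_cases hi : A i = 0 <;> simp [tits, hi]
  simp only [hopp, Finset.mul_sum, Finset.sum_filter, mul_ite, mul_zero]
  have hswap : ∀ F : ι → SignType,
      (if IsFace a b F ∧ faceLE A F ∧ faceLE F D then
        ∑ C, (if IsChamber a b C ∧ tits F C = D then
          (-1 : R) ^ (fdim a b F - minDim a b) * x C else 0) else 0) =
      ∑ C, if IsChamber a b C then
        (if IsFace a b F ∧ faceLE A F ∧ faceLE F D ∧ tits F C = D then
          (-1 : R) ^ (fdim a b F - minDim a b) else 0) * x C else 0 := by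
    intro F
    by_cases hF : IsFace a b F ∧ faceLE A F ∧ faceLE F D
    · rw [if_pos hF]
      refine Finset.sum_congr rfl fun C _ => ?_
      by_cases hC : IsChamber a b C <;> by_cases ht : tits F C = D <;> simp [hF, hC, ht]
    · rw [if_neg hF, eq_comm]
      refine Finset.sum_eq_zero fun C _ => ?_
      have h : ¬ (IsFace a b F ∧ faceLE A F ∧ faceLE F D ∧ tits F C = D) :=
        fun h => hF ⟨h.1, h.2.1, h.2.2.1⟩
      simp [h]
  have hcast : ∀ C : ι → SignType,
      (∑ F : ι → SignType, if IsFace a b F ∧ faceLE A F ∧ faceLE F D ∧ tits F C = D then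
        (-1 : R) ^ (fdim a b F - minDim a b) else 0) =
      ((∑ F ∈ Finset.univ.filter (fun F : ι → SignType =>
          IsFace a b F ∧ faceLE A F ∧ faceLE F D ∧ tits F C = D),
        (-1 : ℤ) ^ (fdim a b F - minDim a b) : ℤ) : R) := by
    intro C
    rw [← Finset.sum_filter]
    push_cast
    rfl
  rw [Finset.sum_congr rfl fun F _ => hswap F, Finset.sum_comm]
  refine Finset.sum_congr rfl fun C _ => ?_
  by_cases hC : IsChamber a b C
  · simp only [hC, if_true, true_and]
    rw [← Finset.sum_mul, hcast C]
    by_cases h : ∀ i, A i = 0 → C i = -(D i)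
    · rw [h1 C hC h, if_pos h]
      push_cast
      rfl
    · rw [h2 C hC h, if_neg h, Int.cast_zero, zero_mul]
  · simp [hC]

end Varchenko
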